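/- Delay simulation refines standard simulation: let A1 = (S1, step1, F1) and A2 = (S2, step2, F2) be Büchi automata over the same event type E. Then fsimL_delay ≤ gfp Match, where gfp Match is the standard (largest) simulation relation between the underlying labeled transition systems. -/

import Mathlib

namespace AFS

/-- Greatest fixed point (Knaster–Tarski): for a monotone `f`, this is the
greatest fixed point of `f`. -/
def gfp {α : Type*} [CompleteLattice α] (f : α → α) : α := sSup {a | a ≤ f a}

/-- Least fixed point (Knaster–Tarski): for a monotone `f`, this is the
least fixed point of `f`. -/
def lfp {α : Type*} [CompleteLattice α] (f : α → α) : α := sInf {a | f a ≤ a}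

variable {E S S1 S2 : Type*}

/-- `ρ` is a run of the transition relation `step` from state `s` over the infinite word `τ`. -/
def IsRun (step : S → E → S → Prop) (s : S) (τ : ℕ → E) (ρ : ℕ → S) : Prop :=
  ρ 0 = s ∧ ∀ n, step (ρ n) (τ n) (ρ (n + 1))

/-- Büchi language of a state: words admitting a run visiting `F` infinitely often. -/
def Lang (step : S → E → S → Prop) (F : Set S) (s : S) : Set (ℕ → E) :=
  {τ | ∃ ρ, IsRun step s τ ρ ∧ {n | ρ n ∈ F}.Infinite}

/-- Traces of a state: words admitting a run (no acceptance requirement). -/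
def Traces (step : S → E → S → Prop) (s : S) : Set (ℕ → E) :=
  {τ | ∃ ρ, IsRun step s τ ρ}

/-- One-step matching operator on relations. -/
def Match (step1 : S1 → E → S1 → Prop) (step2 : S2 → E → S2 → Prop)
    (X : S1 → S2 → Prop) : S1 → S2 → Prop :=
  fun s1 s2 => ∀ e s1', step1 s1 e s1' → ∃ s2', step2 s2 e s2' ∧ X s1' s2'

/-- Inductive part of delay simulation: reach a right-accepting state, then pass to `X`. -/
def fsimRdelay (step1 : S1 → E → S1 → Prop) (step2 : S2 → E → S2 → Prop)
    (F2 : Set S2) (X : S1 → S2 → Prop) : S1 → S2 → Prop :=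
  lfp (fun Y =>
    (fun s1 s2 => s2 ∈ F2 ∧ Match step1 step2 X s1 s2) ⊔ Match step1 step2 Y)

/-- Functor underlying delay simulation. -/
def fsimLdelayF (step1 : S1 → E → S1 → Prop) (F1 : Set S1)
    (step2 : S2 → E → S2 → Prop) (F2 : Set S2)
    (X : S1 → S2 → Prop) : S1 → S2 → Prop :=
  fsimRdelay step1 step2 F2 X ⊔ (fun s1 s2 => s1 ∉ F1 ∧ Match step1 step2 X s1 s2)

/-- Delay simulation. -/
def fsimLdelay (step1 : S1 → E → S1 → Prop) (F1 : Set S1)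
    (step2 : S2 → E → S2 → Prop) (F2 : Set S2) : S1 → S2 → Prop :=
  gfp (fsimLdelayF step1 F1 step2 F2)

theorem le_map_gfp {α : Type*} [CompleteLattice α] {f : α → α} (hf : Monotone f) :
    gfp f ≤ f (gfp f) :=
  sSup_le fun _ ha => le_trans ha (hf (le_sSup ha))

theorem map_gfp_le {α : Type*} [CompleteLattice α] {f : α → α} (hf : Monotone f) :
    f (gfp f) ≤ gfp f :=
  le_sSup (hf (le_map_gfp hf))

theorem map_lfp_le {α : Type*} [CompleteLattice α] {f : α → α} (hf : Monotone f) :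
    f (lfp f) ≤ lfp f :=
  le_sInf fun _ ha => le_trans (hf (sInf_le ha)) ha

theorem lfp_le_map {α : Type*} [CompleteLattice α] {f : α → α} (hf : Monotone f) :
    lfp f ≤ f (lfp f) :=
  sInf_le (hf (map_lfp_le hf))

theorem match_mono (step1 : S1 → E → S1 → Prop) (step2 : S2 → E → S2 → Prop) :
    Monotone (Match step1 step2) := by
  intro X Y hXY s1 s2 h e s1' hs
  obtain ⟨s2', hs2, hX⟩ := h e s1' hs
  exact ⟨s2', hs2, hXY _ _ hX⟩

theorem fsimRdelay_mono (step1 : S1 → E → S1 → Prop) (step2 : S2 → E → S2 → Prop)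
    (F2 : Set S2) : Monotone (fsimRdelay step1 step2 F2) := by
  intro X Y hXY
  have h : (fun s1 s2 => s2 ∈ F2 ∧ Match step1 step2 X s1 s2) ≤
      (fun s1 s2 => s2 ∈ F2 ∧ Match step1 step2 Y s1 s2) :=
    fun s1 s2 h => ⟨h.1, match_mono step1 step2 hXY s1 s2 h.2⟩
  exact le_sInf fun Z hZ => sInf_le (le_trans (sup_le_sup_right h (Match step1 step2 Z)) hZ)

theorem fsimLdelayF_mono (step1 : S1 → E → S1 → Prop) (F1 : Set S1)
    (step2 : S2 → E → S2 → Prop) (F2 : Set S2) :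
    Monotone (fsimLdelayF step1 F1 step2 F2) := fun _ _ hXY =>
  sup_le_sup (fsimRdelay_mono step1 step2 F2 hXY)
    fun s1 s2 h => ⟨h.1, match_mono step1 step2 hXY s1 s2 h.2⟩

/-- The inductive part of delay simulation only relates states matching one step into `X` or
into the inductive part itself. -/
theorem fsimRdelay_le (step1 : S1 → E → S1 → Prop) (step2 : S2 → E → S2 → Prop)
    (F2 : Set S2) (X : S1 → S2 → Prop) :
    fsimRdelay step1 step2 F2 X ≤
      Match step1 step2 X ⊔ Match step1 step2 (fsimRdelay step1 step2 F2 X) :=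
  le_trans (lfp_le_map fun _ _ hYZ => sup_le_sup_left (match_mono step1 step2 hYZ) _)
    (sup_le_sup_right (fun _ _ h => h.2) _)

/-- Delay simulation refines standard simulation `gfp Match`. -/
theorem stmt7 (step1 : S1 → E → S1 → Prop) (F1 : Set S1)
    (step2 : S2 → E → S2 → Prop) (F2 : Set S2) :
    fsimLdelay step1 F1 step2 F2 ≤ gfp (Match step1 step2) := by
  have hF := fsimLdelayF_mono step1 F1 step2 F2
  have hR : fsimRdelay step1 step2 F2 (fsimLdelay step1 F1 step2 F2) ≤
      fsimLdelay step1 F1 step2 F2 :=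
    le_trans le_sup_left (map_gfp_le hF)
  refine le_sSup (le_trans (le_map_gfp hF) (sup_le ?_ fun _ _ h => h.2))
  exact le_trans (fsimRdelay_le step1 step2 F2 _)
    (sup_le le_rfl (match_mono step1 step2 hR))

end AFS
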